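/- Transitive composition of relational Hoare triples with product-form frames: for every step relation R on a state type Σ, relational conditions P P' Q Q' : Set (Σ × Σ), unary frames F0 F1 F2 : Set (Σ × Σ), and step functions fn0 fn1 fn2 : Σ → ℕ, if ensures2 R fn0 fn1 P Q {((s0, s1), (s0', s1')) | (s0, s0') ∈ F0 ∧ (s1, s1') ∈ F1} and ensures2 R fn1 fn2 P' Q' {((s0, s1), (s0', s1')) | (s0, s0') ∈ F1 ∧ (s1, s1') ∈ F2} hold, then ensures2 R fn0 fn2 (P ∘ P') (Q ∘ Q') {((s0, s1), (s0', s1')) | (s0, s0') ∈ F0 ∧ (s1, s1') ∈ F2} holds, where for X Y : Set (Σ × Σ), X ∘ Y := {(s, s'') | ∃ s', (s, s') ∈ X ∧ (s', s'') ∈ Y}. -/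

import Mathlib

universe u

variable {σ : Type u}

/-- n-fold composition of a step relation. -/
def relIter (R : σ → σ → Prop) : ℕ → σ → σ → Prop
  | 0, s, s' => s = s'
  | n + 1, s, s'' => ∃ s', R s s' ∧ relIter R n s' s''

/-- The `eventually` operator, defined inductively. -/
inductive EventuallyRel (R : σ → σ → Prop) (Q : Set σ) : σ → Prop
  | base {s : σ} : s ∈ Q → EventuallyRel R Q s
  | step {s : σ} : (∃ s', R s s') → (∀ s', R s s' → EventuallyRel R Q s') →
      EventuallyRel R Q s

/-- The set of states from which `Q` eventually holds. -/
def eventually (R : σ → σ → Prop) (Q : Set σ) : Set σ := {s | EventuallyRel R Q s}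

/-- The stronger eventually operator with an explicit number of steps. -/
def eventuallyN (R : σ → σ → Prop) (n : ℕ) (Q : Set σ) : Set σ :=
  {s | (∀ s', relIter R n s s' → s' ∈ Q) ∧
       (∀ l, l < n → ∀ s', relIter R l s s' → ∃ s'', R s' s'')}

/-- Ordinary unary Hoare triple. -/
def ensures (R : σ → σ → Prop) (P Q : Set σ) (F : Set (σ × σ)) : Prop :=
  ∀ s ∈ P, s ∈ eventually R {s' | s' ∈ Q ∧ (s, s') ∈ F}

/-- Stronger unary Hoare triple with a step function. -/
def ensuresN (R : σ → σ → Prop) (fn : σ → ℕ) (P Q : Set σ) (F : Set (σ × σ)) : Prop :=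
  ∀ s ∈ P, s ∈ eventuallyN R (fn s) {s' | s' ∈ Q ∧ (s, s') ∈ F}

/-- Relational Hoare triple. -/
def ensures2 (R : σ → σ → Prop) (fn0 fn1 : σ → ℕ) (P Q : Set (σ × σ))
    (F : Set ((σ × σ) × (σ × σ))) : Prop :=
  ∀ s0 s1, (s0, s1) ∈ P →
    s0 ∈ eventuallyN R (fn0 s0) {s0' | s1 ∈ eventuallyN R (fn1 s1)
      {s1' | (s0', s1') ∈ Q ∧ ((s0, s1), (s0', s1')) ∈ F}}

/-- If no execution of fewer than `n` steps is stuck, some execution of `n` steps exists. -/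
theorem exists_relIter {R : σ → σ → Prop} {n : ℕ} {s : σ}
    (h : ∀ l, l < n → ∀ s', relIter R l s s' → ∃ s'', R s' s'') : ∃ s', relIter R n s s' := by
  induction n generalizing s with
  | zero => exact ⟨s, rfl⟩
  | succ n ih =>
    obtain ⟨t, ht⟩ := h 0 n.succ_pos s rfl
    obtain ⟨u, hu⟩ := ih fun l hl s' hs' => h (l + 1) (Nat.succ_lt_succ hl) s' ⟨t, ht, hs'⟩
    exact ⟨u, t, ht, hu⟩

theorem ensures2_trans_frames (R : σ → σ → Prop) (P P' Q Q' : Set (σ × σ))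
    (F0 F1 F2 : Set (σ × σ)) (fn0 fn1 fn2 : σ → ℕ)
    (h1 : ensures2 R fn0 fn1 P Q
      {q | (q.1.1, q.2.1) ∈ F0 ∧ (q.1.2, q.2.2) ∈ F1})
    (h2 : ensures2 R fn1 fn2 P' Q'
      {q | (q.1.1, q.2.1) ∈ F1 ∧ (q.1.2, q.2.2) ∈ F2}) :
    ensures2 R fn0 fn2
      {p | ∃ s', (p.1, s') ∈ P ∧ (s', p.2) ∈ P'}
      {p | ∃ s', (p.1, s') ∈ Q ∧ (s', p.2) ∈ Q'}
      {q | (q.1.1, q.2.1) ∈ F0 ∧ (q.1.2, q.2.2) ∈ F2} := by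
  rintro s0 s2 ⟨s1, hP, hP'⟩
  obtain ⟨post0, progress0⟩ := h1 s0 s1 hP
  obtain ⟨post1, progress1⟩ := h2 s1 s2 hP'
  obtain ⟨s1', hs1'⟩ := exists_relIter progress1
  obtain ⟨post2, progress2⟩ := post1 s1' hs1'
  refine ⟨fun s0' hs0' => ⟨fun s2' hs2' => ?_, progress2⟩, progress0⟩
  obtain ⟨hQ, hF0, -⟩ := (post0 s0' hs0').1 s1' hs1'
  obtain ⟨hQ', -, hF2⟩ := post2 s2' hs2'
  exact ⟨⟨s1', hQ, hQ'⟩, hF0, hF2⟩
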